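/- Let R be an integral domain and * a star operation on R that is spectral and of finite type (i.e. * is of finite type and (I ∩ J)^* = I^* ∩ J^* for all fractional ideals I, J). If R is Clifford *-regular, then R has *-finite character: every nonzero element of R lies in only finitely many *-maximal ideals. -/

import Mathlib

open scoped Pointwise

section Defs

variable (A K : Type*) [CommRing A] [Field K] [Algebra A K]

/-- `I` is a nonzero fractional ideal of `A` (inside `K`):
`I ≠ 0` and `dI ⊆ A` for some nonzero `d ∈ A`. -/
def IsFrac (I : Submodule A K) : Prop :=
  I ≠ ⊥ ∧ ∃ d : A, d ≠ 0 ∧ ∀ x ∈ I, ∃ a : A, algebraMap A K d * x = algebraMap A K a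

/-- The divisorial closure `I^v = (A : (A : I))`; here `(J : I) = J / I` and
`(1 : Submodule A K)` is the image of `A` in `K`. -/
def vS (I : Submodule A K) : Submodule A K := 1 / (1 / I)

/-- The `t`-operation `I^t = ⋃ {J^v : J ⊆ I nonzero finitely generated}` (a directed union,
hence equal to the supremum of submodules). -/
def tS (I : Submodule A K) : Submodule A K :=
  ⨆ J ∈ {J : Submodule A K | J ≠ ⊥ ∧ J.FG ∧ J ≤ I}, vS A K J

/-- The image of an integral ideal of `A` in `K`. -/
def idealK (I : Ideal A) : Submodule A K := Submodule.map (Algebra.linearMap A K) I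

/-- A nonzero (fractional) ideal `I` is stable if `I((I:I):I) = (I:I)`. -/
def IsStableIdeal (I : Submodule A K) : Prop := I * ((I / I) / I) = I / I

/-- `A` is a stable domain: every nonzero (fractional) ideal is stable. -/
def StableDomain : Prop := ∀ I : Submodule A K, IsFrac A K I → IsStableIdeal A K I

/-- `A` is Clifford regular: every nonzero (fractional) ideal `I` satisfies `I = I²J`
for some nonzero `A`-submodule `J` of `K`. -/
def CliffordRegularDomain : Prop :=
  ∀ I : Submodule A K, IsFrac A K I → ∃ J : Submodule A K, J ≠ ⊥ ∧ I = I * I * J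

end Defs
section Star

variable (R K : Type*) [CommRing R] [IsDomain R] [Field K] [Algebra R K] [IsFractionRing R K]

/-- A star operation on the domain `R` with quotient field `K`: a map on (nonzero)
fractional ideals satisfying `(aI)^* = aI^*`, `R^* = R`, `I ⊆ I^*`, monotonicity and
idempotency. -/
structure StarOperation : Type _ where
  star : Submodule R K → Submodule R K
  star_frac : ∀ I, IsFrac R K I → IsFrac R K (star I)
  star_smul : ∀ (a : K), a ≠ 0 → ∀ I, IsFrac R K I → star (a • I) = a • star I
  star_one : star (1 : Submodule R K) = 1
  le_star : ∀ I, IsFrac R K I → I ≤ star I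
  star_mono : ∀ I J, IsFrac R K I → IsFrac R K J → I ≤ J → star I ≤ star J
  star_star : ∀ I, IsFrac R K I → star (star I) = star I

variable {R K}

/-- `*` is of finite type: `I^* = ⋃ {J^* : J ⊆ I nonzero finitely generated}`. -/
def StarOperation.FiniteType (s : StarOperation R K) : Prop :=
  ∀ I, IsFrac R K I →
    s.star I = ⨆ J ∈ {J : Submodule R K | J ≠ ⊥ ∧ J.FG ∧ J ≤ I}, s.star J

/-- `I` is `*`-stable: with `E := (I^* : I^*)`, one has `(I^*(E : I^*))^* = E`. -/
def StarOperation.Stable (s : StarOperation R K) (I : Submodule R K) : Prop :=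
  s.star (s.star I * ((s.star I / s.star I) / s.star I)) = s.star I / s.star I

/-- `I` is Clifford `*`-regular: `I^* = (I²J)^*` for some nonzero ideal `J`. -/
def StarOperation.Regular (s : StarOperation R K) (I : Submodule R K) : Prop :=
  ∃ J : Submodule R K, IsFrac R K J ∧ s.star I = s.star (I * I * J)

/-- `I` is Boole `*`-regular: `(I²)^* = xI^*` for some nonzero `x ∈ K`. -/
def StarOperation.BooleRegular (s : StarOperation R K) (I : Submodule R K) : Prop :=
  ∃ x : K, x ≠ 0 ∧ s.star (I * I) = x • s.star I

/-- `I` is strongly `*`-stable: `I^* = xE` for some nonzero `x ∈ K`, where `E = (I^* : I^*)`. -/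
def StarOperation.StronglyStable (s : StarOperation R K) (I : Submodule R K) : Prop :=
  ∃ x : K, x ≠ 0 ∧ s.star I = x • (s.star I / s.star I)

end Star

/-- `M` is a `*`-maximal ideal of `R`: an integral `*`-ideal maximal among proper integral
`*`-ideals. -/
def StarOperation.MaxIdeal {R K : Type*} [CommRing R] [IsDomain R] [Field K] [Algebra R K]
    [IsFractionRing R K] (s : StarOperation R K) (M : Ideal R) : Prop :=
  M ≠ ⊤ ∧ s.star (idealK R K M) = idealK R K M ∧
    ∀ J : Ideal R, J ≠ ⊤ → s.star (idealK R K J) = idealK R K J → M ≤ J → J = M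

section Saturation

variable {R K : Type*} [CommRing R] [CommRing K] [Algebra R K]

/-- The `S`-saturation of a submodule: all `x` with `s • x ∈ N` for some `s ∈ S`. When `S` is the
complement of a prime `M` this is the localization `N_M` viewed inside `K`. -/
def saturation (S : Submonoid R) (N : Submodule R K) : Submodule R K where
  carrier := {x | ∃ s ∈ S, s • x ∈ N}
  zero_mem' := ⟨1, S.one_mem, by simp⟩
  add_mem' := by
    rintro x y ⟨s, hs, hx⟩ ⟨t, ht, hy⟩
    refine ⟨s * t, S.mul_mem hs ht, ?_⟩
    rw [smul_add]
    refine N.add_mem ?_ ?_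
    · rw [mul_comm, mul_smul]; exact N.smul_mem _ hx
    · rw [mul_smul]; exact N.smul_mem _ hy
  smul_mem' := by
    rintro r x ⟨s, hs, hx⟩
    exact ⟨s, hs, by rw [smul_comm]; exact N.smul_mem _ hx⟩

variable {S : Submonoid R} {A B C D : Submodule R K}

lemma mem_saturation {x : K} : x ∈ saturation S A ↔ ∃ s ∈ S, s • x ∈ A := Iff.rfl

lemma le_saturation_of_le (h : A ≤ B) : A ≤ saturation S B :=
  fun x hx => ⟨1, S.one_mem, by simpa using h hx⟩

lemma saturation_trans (h : A ≤ saturation S B) (h' : B ≤ saturation S C) :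
    A ≤ saturation S C := by
  intro x hx
  obtain ⟨s, hs, hsx⟩ := h hx
  obtain ⟨t, ht, htx⟩ := h' hsx
  exact ⟨t * s, S.mul_mem ht hs, by rwa [mul_smul]⟩

lemma saturation_mul (h : A ≤ saturation S C) (h' : B ≤ saturation S D) :
    A * B ≤ saturation S (C * D) := by
  rw [Submodule.mul_le]
  intro a ha b hb
  obtain ⟨s, hs, hsa⟩ := h ha
  obtain ⟨t, ht, htb⟩ := h' hb
  exact ⟨s * t, S.mul_mem hs ht, by
    rw [← smul_mul_smul_comm]; exact Submodule.mul_mem_mul hsa htb⟩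

lemma saturation_mul_self (h : 1 ≤ saturation S A) (h' : 1 ≤ saturation S B) :
    1 ≤ saturation S (A * B) := by
  simpa using saturation_mul h h'

lemma one_le_saturation : 1 ≤ saturation S A ↔ ∃ s ∈ S, algebraMap R K s ∈ A := by
  rw [Submodule.one_le, mem_saturation]
  simp only [Algebra.algebraMap_eq_smul_one]

end Saturation

section Nakayama

variable {R K : Type*} [CommRing R] [Field K] [Algebra R K]

/-- The subalgebra `R + P` generated by a multiplicatively closed submodule `P`. -/
def unitalClosure (P : Submodule R K) (hP : P * P ≤ P) : Subalgebra R K :=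
  (1 ⊔ P).toSubalgebra (Submodule.mem_sup_left (Submodule.one_le.1 le_rfl)) (by
    intro x y hx hy
    have h : (1 ⊔ P) * (1 ⊔ P) ≤ 1 ⊔ P := by
      rw [Submodule.sup_mul, Submodule.mul_sup, Submodule.mul_sup]
      simp only [one_mul, mul_one]
      exact sup_le le_rfl (sup_le le_sup_right (hP.trans le_sup_right))
    exact h (Submodule.mul_mem_mul hx hy))

/-- The multiplicatively closed submodule `P` as an ideal of `R + P`. -/
def unitalClosureIdeal (P : Submodule R K) (hP : P * P ≤ P) : Ideal (unitalClosure P hP) where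
  carrier := {x | (x : K) ∈ P}
  zero_mem' := P.zero_mem
  add_mem' := P.add_mem
  smul_mem' := by
    rintro ⟨c, hc⟩ x hx
    have h : (1 ⊔ P) * P ≤ P := by
      rw [Submodule.sup_mul, one_mul]
      exact sup_le le_rfl hP
    exact h (Submodule.mul_mem_mul hc hx)

lemma one_mem_of_fg_of_le_mul {P X : Submodule R K} (hP : P * P ≤ P) (hX : X.FG) (h0 : X ≠ ⊥)
    (h : X ≤ X * P) : (1 : K) ∈ P := by
  let T := unitalClosure P hP
  let N : Submodule T K := Submodule.span T (X : Set K)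
  have hN : N.FG := by
    obtain ⟨t, rfl⟩ := hX
    refine ⟨t, le_antisymm (Submodule.span_mono Submodule.subset_span) ?_⟩
    rw [Submodule.span_le]
    exact Submodule.span_subset_span R T _
  have hle : N ≤ unitalClosureIdeal P hP • N := by
    rw [Submodule.span_le]
    intro x hx
    refine Submodule.mul_induction_on (h hx) ?_ fun _ _ => Submodule.add_mem _
    intro y hy p hp
    have hpT : p ∈ T := Submodule.mem_sup_right hp
    have : y * p = (⟨p, hpT⟩ : T) • y := mul_comm _ _
    rw [this]
    exact Submodule.smul_mem_smul hp (Submodule.subset_span hy)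
  obtain ⟨r, hr, hr0⟩ :=
    Submodule.exists_sub_one_mem_and_smul_eq_zero_of_fg_of_le_smul _ N hN hle
  obtain ⟨x, hx, hx0⟩ := Submodule.exists_mem_ne_zero_of_ne_bot h0
  have h1 : (r : K) * x = 0 := hr0 x (Submodule.subset_span hx)
  have h2 : (r : K) = 0 := (mul_eq_zero.1 h1).resolve_right hx0
  have h3 : (r : K) - 1 ∈ P := hr
  rw [h2, zero_sub] at h3
  simpa using P.neg_mem h3

lemma one_le_saturation_of_fg {S : Submonoid R} {I L : Submodule R K} (hI : I.FG) (h0 : I ≠ ⊥)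
    (hS : ∀ s ∈ S, algebraMap R K s ≠ 0) (h : I ≤ saturation S (I * L))
    (hL : L * L ≤ saturation S L) : 1 ≤ saturation S L := by
  rw [Submodule.one_le]
  refine one_mem_of_fg_of_le_mul (saturation_trans (saturation_mul le_rfl le_rfl) hL) hI h0 ?_
  intro y hy
  obtain ⟨s, hs, hsy⟩ := h hy
  have hne := hS s hs
  have key : ∀ z ∈ I * L, (algebraMap R K s)⁻¹ * z ∈ I * saturation S L := by
    intro z hz
    refine Submodule.mul_induction_on hz ?_ ?_
    · intro a ha l hl
      rw [mul_left_comm]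
      refine Submodule.mul_mem_mul ha ⟨s, hs, ?_⟩
      rwa [Algebra.smul_def, mul_inv_cancel_left₀ hne]
    · intro a b ha hb
      rw [mul_add]
      exact Submodule.add_mem _ ha hb
  have := key _ hsy
  rwa [Algebra.smul_def, inv_mul_cancel_left₀ hne] at this

end Nakayama

section IsFrac

variable {R K : Type*} [CommRing R] [Field K] [Algebra R K]

lemma IsFrac.mono {I J : Submodule R K} (hI : IsFrac R K I) (hJ : J ≠ ⊥) (h : J ≤ I) :
    IsFrac R K J := by
  obtain ⟨_, d, hd, hdI⟩ := hI
  exact ⟨hJ, d, hd, fun x hx => hdI x (h hx)⟩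

lemma isFrac_of_le_one {I : Submodule R K} [Nontrivial R] (h0 : I ≠ ⊥) (h : I ≤ 1) :
    IsFrac R K I := by
  refine ⟨h0, 1, one_ne_zero, fun x hx => ?_⟩
  obtain ⟨a, ha⟩ := Submodule.mem_one.1 (h hx)
  exact ⟨a, by simp [ha]⟩

lemma IsFrac.mul [IsDomain R] {I J : Submodule R K} (hI : IsFrac R K I) (hJ : IsFrac R K J) :
    IsFrac R K (I * J) := by
  obtain ⟨hI0, d, hd, hdI⟩ := hI
  obtain ⟨hJ0, e, he, heJ⟩ := hJ
  refine ⟨?_, d * e, mul_ne_zero hd he, fun x hx => ?_⟩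
  · obtain ⟨x, hx, hx0⟩ := Submodule.exists_mem_ne_zero_of_ne_bot hI0
    obtain ⟨y, hy, hy0⟩ := Submodule.exists_mem_ne_zero_of_ne_bot hJ0
    intro h
    have := Submodule.mul_mem_mul hx hy
    rw [h, Submodule.mem_bot] at this
    exact mul_ne_zero hx0 hy0 this
  · refine Submodule.mul_induction_on hx ?_ ?_
    · intro a ha b hb
      obtain ⟨u, hu⟩ := hdI a ha
      obtain ⟨v, hv⟩ := heJ b hb
      exact ⟨u * v, by rw [map_mul, map_mul, ← hu, ← hv]; ring⟩
    · rintro a b ⟨u, hu⟩ ⟨v, hv⟩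
      exact ⟨u + v, by rw [map_add, ← hu, ← hv]; ring⟩

lemma idealK_le_one (I : Ideal R) : idealK R K I ≤ 1 := by
  rintro _ ⟨a, -, rfl⟩
  exact Submodule.mem_one.2 ⟨a, rfl⟩

lemma idealK_mono {I J : Ideal R} (h : I ≤ J) : idealK R K I ≤ idealK R K J :=
  Submodule.map_mono h

lemma idealK_comap_of_le_one {N : Submodule R K} (h : N ≤ 1) :
    idealK R K (N.comap (Algebra.linearMap R K)) = N := by
  rw [idealK, Submodule.map_comap_eq, inf_eq_right]
  intro x hx
  obtain ⟨r, rfl⟩ := Submodule.mem_one.1 (h hx)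
  exact ⟨r, rfl⟩

/-- The ideal of all `r` with `r • x ∈ N`. -/
def elementColon (N : Submodule R K) (x : K) : Ideal R :=
  N.comap (LinearMap.toSpanSingleton R K x)

lemma mem_elementColon {N : Submodule R K} {x : K} {r : R} :
    r ∈ elementColon N x ↔ r • x ∈ N := Iff.rfl

lemma isFrac_idealK [Nontrivial R] {I : Ideal R} (h : idealK R K I ≠ ⊥) :
    IsFrac R K (idealK R K I) :=
  isFrac_of_le_one h (idealK_le_one I)

lemma idealK_elementColon (N : Submodule R K) {x : K} (hx : x ≠ 0) :
    idealK R K (elementColon N x) = x⁻¹ • N ⊓ 1 := by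
  ext y
  rw [Submodule.mem_inf, Submodule.mem_smul_pointwise_iff_exists, Submodule.mem_one]
  constructor
  · rintro ⟨r, hr, rfl⟩
    refine ⟨⟨r • x, hr, ?_⟩, r, rfl⟩
    rw [smul_eq_mul, Algebra.smul_def, mul_left_comm, inv_mul_cancel₀ hx, mul_one]
    rfl
  · rintro ⟨⟨n, hn, hny⟩, r, rfl⟩
    refine ⟨r, ?_, rfl⟩
    have : r • x = n := by
      rw [Algebra.smul_def, ← hny, smul_eq_mul, mul_comm, mul_inv_cancel_left₀ hx]
    exact mem_elementColon.2 (this ▸ hn)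

variable [IsFractionRing R K]

lemma algebraMap_mem_idealK {I : Ideal R} {a : R} : algebraMap R K a ∈ idealK R K I ↔ a ∈ I := by
  constructor
  · rintro ⟨b, hb, h⟩
    rwa [← IsFractionRing.injective R K h]
  · exact fun h => ⟨a, h, rfl⟩

lemma idealK_ne_bot {I : Ideal R} {a : R} (ha : a ≠ 0) (h : a ∈ I) : idealK R K I ≠ ⊥ := by
  intro hb
  have := (algebraMap_mem_idealK (K := K)).2 h
  rw [hb, Submodule.mem_bot] at this
  exact ha ((map_eq_zero_iff _ (IsFractionRing.injective R K)).1 this)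

lemma ideal_fg_of_idealK_fg {I : Ideal R} (h : (idealK R K I).FG) : I.FG :=
  Submodule.fg_of_fg_map_injective (Algebra.linearMap R K) (IsFractionRing.injective R K) h

lemma one_le_saturation_idealK {M I : Ideal R} [M.IsPrime] :
    1 ≤ saturation M.primeCompl (idealK R K I) ↔ ¬ I ≤ M := by
  simp only [one_le_saturation, algebraMap_mem_idealK, SetLike.not_le_iff_exists]
  exact ⟨fun ⟨s, h, h'⟩ => ⟨s, h', h⟩, fun ⟨s, h, h'⟩ => ⟨s, h', h⟩⟩

end IsFrac

section Family

variable {R K : Type*} [CommRing R] [IsDomain R] [Field K] [Algebra R K] [IsFractionRing R K]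
  {κ : Type*} {𝓜 : κ → Ideal R} [∀ k, (𝓜 k).IsPrime]

/-- In a domain that is Clifford regular locally on a family of primes, a finitely generated ideal
`I` admits a local inverse `B` over the ring `(I : I)`. -/
lemma exists_local_inverse
    (hone : ∀ y : K, (∀ k, y ∈ saturation (𝓜 k).primeCompl (1 : Submodule R K)) →
      y ∈ (1 : Submodule R K))
    (hreg : ∀ I : Submodule R K, IsFrac R K I → ∃ J : Submodule R K,
      ∀ k, I ≤ saturation (𝓜 k).primeCompl (I * I * J) ∧
        I * I * J ≤ saturation (𝓜 k).primeCompl I)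
    {I : Submodule R K} (hfg : I.FG) (hI : I ≤ 1) {r : R} (hr : r ≠ 0)
    (hrI : algebraMap R K r ∈ I) :
    ∃ B : Submodule R K, 1 ≤ B ∧ B * I * B ≤ B ∧
      (∀ x ∈ B, algebraMap R K r * algebraMap R K r * x ∈ (1 : Submodule R K)) ∧
      ∀ k, 1 ≤ saturation (𝓜 k).primeCompl (B * I) ∧
        B * (I * I) ≤ saturation (𝓜 k).primeCompl I := by
  have hinj := IsFractionRing.injective R K
  have h0 : I ≠ ⊥ := by
    rintro rfl
    exact hr ((map_eq_zero_iff _ hinj).1 ((Submodule.mem_bot R).1 hrI))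
  obtain ⟨J, hJ⟩ := hreg I (isFrac_of_le_one h0 hI)
  let B : Submodule R K := (⨅ k, saturation (𝓜 k).primeCompl I) / (I * I)
  have hB : ∀ {N : Submodule R K},
      N ≤ B ↔ ∀ k, N * (I * I) ≤ saturation (𝓜 k).primeCompl I := fun {N} => by
    rw [Submodule.le_div_iff_mul_le, le_iInf_iff]
  have hBI := hB.1 le_rfl
  refine ⟨B, ?_, ?_, ?_, fun k => ⟨?_, hBI k⟩⟩
  · rw [hB]
    intro k
    rw [one_mul]
    exact le_saturation_of_le ((mul_le_mul' hI le_rfl).trans (one_mul I).le)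
  · rw [hB]
    intro k
    have : B * I * B * (I * I) = B * (I * I) * (B * I) := by ring
    rw [this]
    refine saturation_trans (saturation_mul (hBI k) (le_saturation_of_le le_rfl)) ?_
    rw [show I * (B * I) = B * (I * I) by ring]
    exact hBI k
  · intro x hx
    refine hone _ fun k => ?_
    refine saturation_trans (hBI k) (le_saturation_of_le hI) ?_
    rw [mul_comm _ x]
    exact Submodule.mul_mem_mul hx (Submodule.mul_mem_mul hrI hrI)
  · have hJB : J ≤ B := hB.2 fun k => by rw [mul_comm]; exact (hJ k).2
    refine saturation_trans (B := I * J) ?_ (le_saturation_of_le ?_)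
    · refine one_le_saturation_of_fg hfg h0 ?_ ?_ ?_
      · intro s hs h
        rw [map_eq_zero_iff _ hinj] at h
        exact hs (h ▸ (𝓜 k).zero_mem)
      · rw [← mul_assoc]; exact (hJ k).1
      · rw [show I * J * (I * J) = I * I * J * J by ring]
        exact saturation_mul (hJ k).2 (le_saturation_of_le le_rfl)
    · rw [mul_comm]
      exact mul_le_mul' hJB le_rfl

theorem not_infinite_comaximal_family
    (hone : ∀ y : K, (∀ k, y ∈ saturation (𝓜 k).primeCompl (1 : Submodule R K)) →
      y ∈ (1 : Submodule R K))
    (hreg : ∀ I : Submodule R K, IsFrac R K I → ∃ J : Submodule R K,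
      ∀ k, I ≤ saturation (𝓜 k).primeCompl (I * I * J) ∧
        I * I * J ≤ saturation (𝓜 k).primeCompl I)
    (hcpt : ∀ H : Ideal R, (∀ k, ¬ H ≤ 𝓜 k) → ∃ H' ≤ H, H'.FG ∧ ∀ k, ¬ H' ≤ 𝓜 k)
    {ι : Type*} [Infinite ι] {r : R} (hr : r ≠ 0) (I : ι → Ideal R) (hfg : ∀ i, (I i).FG)
    (hrI : ∀ i, r ∈ I i) (hproper : ∀ i, ∃ k, I i ≤ 𝓜 k)
    (hcomax : ∀ i j, i ≠ j → ∀ k, I i ≤ 𝓜 k → ¬ I j ≤ 𝓜 k) : False := by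
  classical
  have hinv := fun i => exists_local_inverse hone hreg (I := idealK R K (I i))
    (Submodule.FG.map _ (hfg i)) (idealK_le_one _) hr (algebraMap_mem_idealK.2 (hrI i))
  choose B hB1 hBIB hBr hBk using hinv
  have hBloc : ∀ {i k}, ¬ I i ≤ 𝓜 k → B i ≤ saturation (𝓜 k).primeCompl 1 := by
    intro i k h
    have h1 := one_le_saturation_idealK (K := K).2 h
    have h2 := saturation_mul (le_saturation_of_le (le_refl (B i))) (saturation_mul_self h1 h1)
    rw [mul_one] at h2
    exact saturation_trans h2 (saturation_trans (hBk i k).2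
      (le_saturation_of_le (idealK_le_one _)))
  obtain ⟨i₀⟩ := (inferInstance : Nonempty ι)
  set A : Submodule R K := ⨆ i, B i with hA
  have hBA : ∀ i, B i ≤ A := le_iSup B
  have hAfrac : IsFrac R K A := by
    refine ⟨?_, r * r, mul_ne_zero hr hr, ?_⟩
    · intro h
      have h1 := Submodule.one_le.1 ((hB1 i₀).trans (hBA i₀))
      rw [h, Submodule.mem_bot] at h1
      exact one_ne_zero h1
    · have : A ≤ (1 : Submodule R K).comap (LinearMap.mulLeft R (algebraMap R K (r * r))) :=
        iSup_le fun i x hx => by simpa [mul_assoc] using hBr i x hx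
      intro x hx
      obtain ⟨a, ha⟩ := Submodule.mem_one.1 (this hx)
      exact ⟨a, ha.symm⟩
  have hAloc : ∀ {i k}, (∀ j, j ≠ i → ¬ I j ≤ 𝓜 k) → A ≤ saturation (𝓜 k).primeCompl (B i) := by
    intro i k h
    refine iSup_le fun j => ?_
    by_cases hj : j = i
    · exact hj ▸ le_saturation_of_le le_rfl
    · exact saturation_trans (hBloc (h j hj)) (le_saturation_of_le (hB1 i))
  obtain ⟨J, hJ⟩ := hreg A hAfrac
  have hAJ : ∀ k, 1 ≤ saturation (𝓜 k).primeCompl (A * J) := by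
    intro k
    obtain ⟨i, hi⟩ : ∃ i, ∀ j, j ≠ i → ¬ I j ≤ 𝓜 k := by
      by_cases h : ∃ i, I i ≤ 𝓜 k
      · obtain ⟨i, hi⟩ := h
        exact ⟨i, fun j hj => hcomax i j hj.symm k hi⟩
      · exact ⟨i₀, fun j _ hj => h ⟨j, hj⟩⟩
    have hself : ∀ N : Submodule R K, N ≤ saturation (𝓜 k).primeCompl N :=
      fun N => le_saturation_of_le le_rfl
    have h1 := saturation_trans (hBk i k).1
      (saturation_mul (le_saturation_of_le (hBA i)) (hself (idealK R K (I i))))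
    have h2 := saturation_trans h1 (saturation_mul (hJ k).1 (hself _))
    have h3 := saturation_trans h2 (saturation_mul (saturation_mul
      (saturation_mul (hAloc hi) (hAloc hi)) (hself _)) (hself _))
    refine saturation_trans h3 (le_saturation_of_le ?_)
    calc B i * B i * J * idealK R K (I i) = B i * idealK R K (I i) * B i * J := by ring
      _ ≤ B i * J := mul_le_mul' (hBIB i) le_rfl
      _ ≤ A * J := mul_le_mul' (hBA i) le_rfl
  obtain ⟨H, hH, hHfg, hHk⟩ := hcpt ((A * J).comap (Algebra.linearMap R K)) (by
    intro k h
    obtain ⟨s, hs, hsAJ⟩ := one_le_saturation.1 (hAJ k)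
    exact hs (h hsAJ))
  have hHAJ : idealK R K H ≤ ⨆ i, B i * J := by
    rw [← Submodule.iSup_mul, ← hA]
    exact Submodule.map_le_iff_le_comap.2 hH
  obtain ⟨t, ht⟩ := CompleteLattice.IsCompactElement.exists_finset_of_le_iSup _
    ((Submodule.fg_iff_compact _).1 (Submodule.FG.map _ hHfg)) _ hHAJ
  obtain ⟨i, hi⟩ := Infinite.exists_notMem_finset t
  obtain ⟨k, hk⟩ := hproper i
  have hothers : ∀ j, j ≠ i → ¬ I j ≤ 𝓜 k := fun j hj => hcomax i j hj.symm k hk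
  have hself : ∀ N : Submodule R K, N ≤ saturation (𝓜 k).primeCompl N :=
    fun N => le_saturation_of_le le_rfl
  have hJ1 : 1 ≤ saturation (𝓜 k).primeCompl J := by
    refine saturation_trans (one_le_saturation_idealK.2 (hHk k)) (ht.trans ?_)
    refine iSup₂_le fun j hj => ?_
    simpa using saturation_mul (hBloc (hothers j fun h => hi (h ▸ hj))) (hself J)
  have hBB : B i * B i ≤ saturation (𝓜 k).primeCompl (B i) := by
    have h1 := saturation_mul (le_saturation_of_le (mul_le_mul' (hBA i) (hBA i))) hJ1
    rw [mul_one] at h1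
    exact saturation_trans h1 (saturation_trans (hJ k).2 (hAloc hothers))
  refine one_le_saturation_idealK (K := K).1 ?_ hk
  refine saturation_trans (saturation_mul_self (hBk i k).1 (hBk i k).1) ?_
  rw [mul_mul_mul_comm]
  exact saturation_trans (saturation_mul hBB (hself _)) (hBk i k).2

end Family

section FiniteCharacter

variable {R : Type*} [CommRing R] {κ : Type*} {𝓜 : κ → Ideal R}

lemma exists_comaximal_fg (hincomp : ∀ k l, 𝓜 k ≤ 𝓜 l → k = l)
    (hcpt : ∀ H : Ideal R, (∀ k, ¬ H ≤ 𝓜 k) → ∃ H' ≤ H, H'.FG ∧ ∀ k, ¬ H' ≤ 𝓜 k)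
    {I : Ideal R} (hI : I.FG) {k l : κ} (hkl : k ≠ l) (hk : I ≤ 𝓜 k) (hl : I ≤ 𝓜 l) :
    ∃ J J' : Ideal R, (J.FG ∧ I ≤ J ∧ J ≤ 𝓜 k) ∧ (J'.FG ∧ I ≤ J' ∧ J' ≤ 𝓜 l) ∧
      ∀ m, J ≤ 𝓜 m → ¬ J' ≤ 𝓜 m := by
  classical
  obtain ⟨H, hH, ⟨t, rfl⟩, hHm⟩ := hcpt (𝓜 k ⊔ 𝓜 l) fun m hm =>
    hkl ((hincomp _ _ (le_sup_left.trans hm)).trans (hincomp _ _ (le_sup_right.trans hm)).symm)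
  have hdec : ∀ x : R, ∃ a b, x ∈ t → a ∈ 𝓜 k ∧ b ∈ 𝓜 l ∧ a + b = x := by
    intro x
    by_cases hx : x ∈ t
    · obtain ⟨a, ha, b, hb, h⟩ := Submodule.mem_sup.1 (hH (Submodule.subset_span hx))
      exact ⟨a, b, fun _ => ⟨ha, hb, h⟩⟩
    · exact ⟨0, 0, fun h => absurd h hx⟩
  choose a b hab using hdec
  refine ⟨I ⊔ Ideal.span (t.image a), I ⊔ Ideal.span (t.image b),
    ⟨Submodule.FG.sup hI ⟨_, rfl⟩, le_sup_left, sup_le hk ?_⟩,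
    ⟨Submodule.FG.sup hI ⟨_, rfl⟩, le_sup_left, sup_le hl ?_⟩, ?_⟩
  · rw [Ideal.span_le]
    intro y hy
    obtain ⟨x, hx, rfl⟩ := Finset.mem_image.1 hy
    exact (hab x hx).1
  · rw [Ideal.span_le]
    intro y hy
    obtain ⟨x, hx, rfl⟩ := Finset.mem_image.1 hy
    exact (hab x hx).2.1
  · intro m hm hm'
    refine hHm m (Submodule.span_le.2 fun x hx => ?_)
    rw [← (hab x hx).2.2]
    exact (𝓜 m).add_mem
      (hm (le_sup_right (a := I) (Ideal.subset_span (Finset.mem_image_of_mem a hx))))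
      (hm' (le_sup_right (a := I) (Ideal.subset_span (Finset.mem_image_of_mem b hx))))

/-- If there is no infinite family of pairwise comaximal finitely generated ideals containing `r`,
then every finitely generated ideal containing `r` and lying in some member of `𝓜` can be enlarged
to a finitely generated ideal lying in exactly one member of `𝓜`. -/
lemma exists_fg_unique (hincomp : ∀ k l, 𝓜 k ≤ 𝓜 l → k = l)
    (hcpt : ∀ H : Ideal R, (∀ k, ¬ H ≤ 𝓜 k) → ∃ H' ≤ H, H'.FG ∧ ∀ k, ¬ H' ≤ 𝓜 k) {r : R}
    (hfam : ∀ I : ℕ → Ideal R, (∀ i, (I i).FG) → (∀ i, r ∈ I i) → (∀ i, ∃ k, I i ≤ 𝓜 k) →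
      ¬ ∀ i j, i ≠ j → ∀ k, I i ≤ 𝓜 k → ¬ I j ≤ 𝓜 k)
    {I : Ideal R} (hI : I.FG) (hrI : r ∈ I) (hproper : ∃ k, I ≤ 𝓜 k) :
    ∃ J : Ideal R, J.FG ∧ I ≤ J ∧ ∃ k, J ≤ 𝓜 k ∧ ∀ l, J ≤ 𝓜 l → l = k := by
  by_contra! hcon
  let T := {J : Ideal R // J.FG ∧ I ≤ J ∧ ∃ k, J ≤ 𝓜 k}
  have hstep : ∀ J : T, ∃ F G : T, J.1 ≤ F.1 ∧ J.1 ≤ G.1 ∧ ∀ m, F.1 ≤ 𝓜 m → ¬ G.1 ≤ 𝓜 m := by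
    rintro ⟨J, hJ, hIJ, k, hk⟩
    obtain ⟨l, hl, hlk⟩ := hcon J hJ hIJ k hk
    obtain ⟨F, G, ⟨hF, hJF, hFk⟩, ⟨hG, hJG, hGl⟩, h⟩ :=
      exists_comaximal_fg hincomp hcpt hJ hlk.symm hk hl
    exact ⟨⟨F, hF, hIJ.trans hJF, k, hFk⟩, ⟨G, hG, hIJ.trans hJG, l, hGl⟩, hJF, hJG, h⟩
  choose F G hF hG hFG using hstep
  let a : ℕ → T := fun n => F^[n] ⟨I, hI, le_rfl, hproper⟩
  have ha : ∀ n, a (n + 1) = F (a n) := fun n => Function.iterate_succ_apply' F n _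
  have hmono : Monotone fun n => (a n).1 :=
    monotone_nat_of_le_succ fun n => by rw [ha]; exact hF _
  have hlt : ∀ i j, i < j → ∀ k, (G (a i)).1 ≤ 𝓜 k → ¬ (G (a j)).1 ≤ 𝓜 k := by
    intro i j hij k hi hj
    refine hFG (a i) k ?_ hi
    rw [← ha]
    exact (hmono (Nat.succ_le_of_lt hij)).trans ((hG _).trans hj)
  refine hfam (fun n => (G (a n)).1) (fun n => (G (a n)).2.1) (fun n => (G (a n)).2.2.1 hrI)
    (fun n => (G (a n)).2.2.2) fun i j hij k hi hj => ?_
  rcases hij.lt_or_gt with h | h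
  · exact hlt i j h k hi hj
  · exact hlt j i h k hj hi

theorem finite_of_no_infinite_comaximal_family (hincomp : ∀ k l, 𝓜 k ≤ 𝓜 l → k = l)
    (hcpt : ∀ H : Ideal R, (∀ k, ¬ H ≤ 𝓜 k) → ∃ H' ≤ H, H'.FG ∧ ∀ k, ¬ H' ≤ 𝓜 k) {r : R}
    (hfam : ∀ I : ℕ → Ideal R, (∀ i, (I i).FG) → (∀ i, r ∈ I i) → (∀ i, ∃ k, I i ≤ 𝓜 k) →
      ¬ ∀ i j, i ≠ j → ∀ k, I i ≤ 𝓜 k → ¬ I j ≤ 𝓜 k) :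
    {k | r ∈ 𝓜 k}.Finite := by
  classical
  let U : Set κ := {k | ∃ J : Ideal R, J.FG ∧ r ∈ J ∧ J ≤ 𝓜 k ∧ ∀ l, J ≤ 𝓜 l → l = k}
  have hU : U.Finite := by
    by_contra hinf
    have : Infinite U := Set.infinite_coe_iff.2 hinf
    choose J hJ hrJ hJk hJu using fun k : U => k.2
    let e := Infinite.natEmbedding U
    exact hfam (fun n => J (e n)) (fun n => hJ _) (fun n => hrJ _) (fun n => ⟨e n, hJk _⟩)
      fun i j hij k hi hj =>
        hij (e.injective (Subtype.ext ((hJu _ k hi).symm.trans (hJu _ k hj))))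
  refine hU.subset fun k hk => ?_
  by_contra hkU
  have hc : ∀ l, ∃ c ∈ 𝓜 k, l ∈ U → c ∉ 𝓜 l := by
    intro l
    by_cases hl : l ∈ U
    · obtain ⟨c, hc, hcl⟩ := SetLike.not_le_iff_exists.1
        fun h => hkU ((hincomp k l h).symm ▸ hl)
      exact ⟨c, hc, fun _ => hcl⟩
    · exact ⟨0, (𝓜 k).zero_mem, fun h => absurd h hl⟩
  choose c hck hcU using hc
  have hsub : Ideal.span (insert r (c '' U)) ≤ 𝓜 k := by
    rw [Ideal.span_le, Set.insert_subset_iff]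
    exact ⟨hk, Set.image_subset_iff.2 fun l _ => hck l⟩
  obtain ⟨J, hJ, hle, l, hl, hlu⟩ := exists_fg_unique hincomp hcpt hfam
    (Submodule.fg_span ((hU.image c).insert r)) (Ideal.subset_span (Set.mem_insert _ _))
    ⟨k, hsub⟩
  have hlU : l ∈ U := ⟨J, hJ, hle (Ideal.subset_span (Set.mem_insert _ _)), hl, hlu⟩
  exact hcU l hlU (hl (hle (Ideal.subset_span
    (Set.mem_insert_of_mem _ (Set.mem_image_of_mem c hlU)))))

end FiniteCharacter

section StarOperation

variable {R K : Type*} [CommRing R] [Field K] [Algebra R K] {s : StarOperation R K}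

namespace StarOperation

lemma star_le_one [IsDomain R] (s : StarOperation R K) {N : Submodule R K} (hN : N ≠ ⊥) (h : N ≤ 1) :
    s.star N ≤ 1 := by
  have h1 : IsFrac R K (1 : Submodule R K) :=
    isFrac_of_le_one (ne_bot_of_le_ne_bot hN h) le_rfl
  exact (s.star_mono _ _ (isFrac_of_le_one hN h) h1 h).trans s.star_one.le

lemma star_le_star_of_le_star {I J : Submodule R K} (hI : IsFrac R K I) (hJ : IsFrac R K J)
    (h : I ≤ s.star J) : s.star I ≤ s.star J :=
  (s.star_mono _ _ hI (s.star_frac _ hJ) h).trans (s.star_star _ hJ).le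

lemma FiniteType.exists_fg (hft : s.FiniteType) {I : Submodule R K} (hI : IsFrac R K I) {x : K}
    (hx : x ∈ s.star I) : ∃ J ≤ I, J ≠ ⊥ ∧ J.FG ∧ x ∈ s.star J := by
  rw [hft I hI, iSup_subtype'] at hx
  have hfrac : ∀ J : {J : Submodule R K | J ≠ ⊥ ∧ J.FG ∧ J ≤ I}, IsFrac R K J.1 :=
    fun J => hI.mono J.2.1 J.2.2.2
  obtain ⟨y, hy, hy0⟩ := Submodule.exists_mem_ne_zero_of_ne_bot hI.1
  have : Nonempty {J : Submodule R K | J ≠ ⊥ ∧ J.FG ∧ J ≤ I} :=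
    ⟨⟨Submodule.span R {y}, by simpa using hy0, Submodule.fg_span_singleton y, by simpa using hy⟩⟩
  rw [Submodule.mem_iSup_of_directed] at hx
  · obtain ⟨⟨J, hJ0, hJ, hJI⟩, hxJ⟩ := hx
    exact ⟨J, hJI, hJ0, hJ, hxJ⟩
  · intro J L
    let P : {J : Submodule R K | J ≠ ⊥ ∧ J.FG ∧ J ≤ I} :=
      ⟨J.1 ⊔ L.1, ne_bot_of_le_ne_bot J.2.1 le_sup_left, J.2.2.1.sup L.2.2.1,
        sup_le J.2.2.2 L.2.2.2⟩
    exact ⟨P, s.star_mono _ _ (hfrac J) (hfrac P) le_sup_left,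
      s.star_mono _ _ (hfrac L) (hfrac P) le_sup_right⟩

end StarOperation

variable [IsDomain R] [IsFractionRing R K]

lemma IsFrac.smul {N : Submodule R K} (hN : IsFrac R K N) {a : K} (ha : a ≠ 0) :
    IsFrac R K (a • N) := by
  obtain ⟨hN0, d, hd, hdN⟩ := hN
  obtain ⟨p, q, hq, rfl⟩ := IsFractionRing.div_surjective (A := R) a
  refine ⟨?_, d * q, mul_ne_zero hd (nonZeroDivisors.ne_zero hq), fun x hx => ?_⟩
  · obtain ⟨y, hy, hy0⟩ := Submodule.exists_mem_ne_zero_of_ne_bot hN0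
    intro h
    have := Submodule.smul_mem_pointwise_smul y (algebraMap R K p / algebraMap R K q) N hy
    rw [h, Submodule.mem_bot, smul_eq_mul] at this
    exact mul_ne_zero ha hy0 this
  · obtain ⟨y, hy, rfl⟩ := (Submodule.mem_smul_pointwise_iff_exists _ _ _).1 hx
    obtain ⟨u, hu⟩ := hdN y hy
    have hq0 : algebraMap R K q ≠ 0 := IsFractionRing.to_map_ne_zero_of_mem_nonZeroDivisors hq
    refine ⟨p * u, ?_⟩
    rw [map_mul, map_mul, ← hu, smul_eq_mul]
    field_simp

lemma idealK_elementColon_ne_bot {N : Submodule R K} (hN : N ≠ ⊥) {x : K} (hx : x ≠ 0) :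
    idealK R K (elementColon N x) ≠ ⊥ := by
  obtain ⟨y, hy, hy0⟩ := Submodule.exists_mem_ne_zero_of_ne_bot hN
  obtain ⟨p, q, hq, hpq⟩ := IsFractionRing.div_surjective (A := R) (y / x)
  have hq0 : algebraMap R K q ≠ 0 := IsFractionRing.to_map_ne_zero_of_mem_nonZeroDivisors hq
  refine idealK_ne_bot (a := p) ?_ ?_
  · rintro rfl
    rw [map_zero, zero_div] at hpq
    exact div_ne_zero hy0 hx hpq.symm
  · have : p • x = q • y := by
      rw [Algebra.smul_def, Algebra.smul_def]
      field_simp at hpq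
      linear_combination hpq
    exact mem_elementColon.2 (this ▸ N.smul_mem q hy)

namespace StarOperation

/-- Two ideals with `*`-closure `R` have a product with `*`-closure `R`. -/
lemma one_mem_star_mul {I J : Ideal R} (hI : idealK R K I ≠ ⊥) (hJ : idealK R K J ≠ ⊥)
    (h1 : (1 : K) ∈ s.star (idealK R K I)) (h2 : (1 : K) ∈ s.star (idealK R K J)) :
    (1 : K) ∈ s.star (idealK R K I * idealK R K J) := by
  have hIJ := (isFrac_idealK hI).mul (isFrac_idealK hJ)
  refine star_le_star_of_le_star (isFrac_idealK hI) hIJ (fun x hx => ?_) h1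
  by_cases hx0 : x = 0
  · exact hx0 ▸ Submodule.zero_mem _
  · have hx1 : x ∈ x • s.star (idealK R K J) := by
      simpa using Submodule.smul_mem_pointwise_smul 1 x _ h2
    rw [← s.star_smul x hx0 _ (isFrac_idealK hJ)] at hx1
    refine s.star_mono _ _ ((isFrac_idealK hJ).smul hx0) hIJ ?_ hx1
    intro y hy
    obtain ⟨z, hz, rfl⟩ := (Submodule.mem_smul_pointwise_iff_exists _ _ _).1 hy
    exact Submodule.mul_mem_mul hx hz

lemma MaxIdeal.one_notMem {M : Ideal R} (hM : s.MaxIdeal M) : (1 : K) ∉ s.star (idealK R K M) := by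
  rw [hM.2.1, ← map_one (algebraMap R K), algebraMap_mem_idealK]
  exact (Ideal.ne_top_iff_one M).1 hM.1

lemma FiniteType.exists_le_maxIdeal (hft : s.FiniteType) {H : Ideal R} (hH : idealK R K H ≠ ⊥)
    (h1 : (1 : K) ∉ s.star (idealK R K H)) : ∃ M, (M ≠ ⊥ ∧ s.MaxIdeal M) ∧ H ≤ M := by
  have hne : ∀ {J : Ideal R}, H ≤ J → idealK R K J ≠ ⊥ :=
    fun h => ne_bot_of_le_ne_bot hH (idealK_mono h)
  have hfrac : ∀ {J : Ideal R}, H ≤ J → IsFrac R K (idealK R K J) := fun h => isFrac_idealK (hne h)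
  obtain ⟨M, hHM, hM⟩ := zorn_le_nonempty₀ {J : Ideal R | H ≤ J ∧ (1 : K) ∉ s.star (idealK R K J)}
    (fun c hc hchain J₀ hJ₀ => by
      have hHc : H ≤ sSup c := (hc hJ₀).1.trans (le_sSup hJ₀)
      refine ⟨sSup c, ⟨hHc, fun h => ?_⟩, fun J hJ => le_sSup hJ⟩
      obtain ⟨F, hF, hF0, hFfg, h1F⟩ := hft.exists_fg (hfrac hHc) h
      have hFfg' : Ideal.FG (F.comap (Algebra.linearMap R K)) := by
        refine ideal_fg_of_idealK_fg (K := K) ?_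
        rwa [idealK_comap_of_le_one (hF.trans (idealK_le_one _))]
      have hle : F.comap (Algebra.linearMap R K) ≤ sSup c := fun r hr =>
        algebraMap_mem_idealK.1 (hF hr)
      obtain ⟨J, hJ, hFJ⟩ := (CompleteLattice.isCompactElement_iff_le_of_directed_sSup_le _ _).1
        ((Submodule.fg_iff_compact _).1 hFfg') c ⟨J₀, hJ₀⟩ hchain.directedOn hle
      refine (hc hJ).2 (s.star_mono _ _ ((hfrac hHc).mono hF0 hF) (hfrac (hc hJ).1) ?_ h1F)
      rw [← idealK_comap_of_le_one (hF.trans (idealK_le_one _))]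
      exact idealK_mono hFJ) H ⟨le_rfl, h1⟩
  have hstar1 := s.star_le_one (hne hHM) (idealK_le_one M)
  have hstar : s.star (idealK R K M) = idealK R K M := by
    refine le_antisymm ?_ (s.le_star _ (hfrac hHM))
    have hmem : M ≤ (s.star (idealK R K M)).comap (Algebra.linearMap R K) := fun r hr =>
      s.le_star _ (hfrac hHM) (algebraMap_mem_idealK.2 hr)
    have hle := hM.2 (y := (s.star (idealK R K M)).comap (Algebra.linearMap R K))
      ⟨hHM.trans hmem, by
        rw [idealK_comap_of_le_one hstar1, s.star_star _ (hfrac hHM)]; exact hM.1.2⟩ hmem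
    rw [← idealK_comap_of_le_one hstar1]
    exact idealK_mono hle
  refine ⟨M, ⟨?_, ?_, hstar, fun J hJ hJs hMJ => le_antisymm (hM.2 ⟨hHM.trans hMJ, ?_⟩ hMJ) hMJ⟩,
    hHM⟩
  · rintro rfl
    exact hne hHM (Submodule.map_bot _)
  · rintro rfl
    refine hM.1.2 (s.le_star _ (hfrac hHM) ?_)
    rw [← map_one (algebraMap R K)]
    exact algebraMap_mem_idealK.2 trivial
  · rw [hJs, ← map_one (algebraMap R K), algebraMap_mem_idealK]
    exact (Ideal.ne_top_iff_one J).1 hJ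

lemma one_mem_star_of_not_le {M I : Ideal R} (hft : s.FiniteType) (hM : M ≠ ⊥)
    (hmax : s.MaxIdeal M) (hMI : M ≤ I) (hI : ¬ I ≤ M) : (1 : K) ∈ s.star (idealK R K I) := by
  by_contra h
  obtain ⟨a, ha, ha0⟩ := Submodule.exists_mem_ne_zero_of_ne_bot hM
  obtain ⟨N, hN, hIN⟩ := hft.exists_le_maxIdeal (idealK_ne_bot ha0 (hMI ha)) h
  exact hI (hIN.trans (hmax.2.2 N hN.2.1 hN.2.2.1 (hMI.trans hIN)).le)

lemma MaxIdeal.isPrime {M : Ideal R} (hft : s.FiniteType) (hM : M ≠ ⊥) (hmax : s.MaxIdeal M) :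
    M.IsPrime := by
  refine ⟨hmax.1, fun {a b} hab => ?_⟩
  by_contra! h
  obtain ⟨m, hm, hm0⟩ := Submodule.exists_mem_ne_zero_of_ne_bot hM
  have hsup : ∀ c ∉ M, (1 : K) ∈ s.star (idealK R K (M ⊔ Ideal.span {c})) := fun c hc =>
    one_mem_star_of_not_le hft hM hmax le_sup_left fun hle =>
      hc (hle (Ideal.mem_sup_right (Ideal.mem_span_singleton_self c)))
  have hne : ∀ c, idealK R K (M ⊔ Ideal.span {c}) ≠ ⊥ := fun c =>
    idealK_ne_bot hm0 (Ideal.mem_sup_left hm)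
  refine hmax.one_notMem (s.star_mono _ _ ((isFrac_idealK (hne a)).mul (isFrac_idealK (hne b)))
    (isFrac_idealK (idealK_ne_bot hm0 hm)) ?_ (one_mem_star_mul (hne a) (hne b)
      (hsup a h.1) (hsup b h.2)))
  rw [Submodule.mul_le]
  rintro _ ⟨x, hx, rfl⟩ _ ⟨y, hy, rfl⟩
  refine ⟨x * y, ?_, map_mul (algebraMap R K) x y⟩
  have hle : (M ⊔ Ideal.span {a}) * (M ⊔ Ideal.span {b}) ≤ M := by
    rw [Ideal.sup_mul, Ideal.mul_sup (Ideal.span {a}), Ideal.span_singleton_mul_span_singleton]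
    exact sup_le Ideal.mul_le_left (sup_le Ideal.mul_le_right
      ((Ideal.span_singleton_le_iff_mem _).2 hab))
  exact hle (Ideal.mul_mem_mul hx hy)

lemma mem_saturation_of_mem_star
    (hinter : ∀ I J : Submodule R K, IsFrac R K I → IsFrac R K J →
      s.star (I ⊓ J) = s.star I ⊓ s.star J)
    {M : Ideal R} [M.IsPrime] (hmax : s.MaxIdeal M) {N : Submodule R K}
    (hN : IsFrac R K N) {x : K} (hx : x ∈ s.star N) : x ∈ saturation M.primeCompl N := by
  by_cases hx0 : x = 0
  · exact hx0 ▸ Submodule.zero_mem _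
  have hxinv := inv_ne_zero hx0
  have hne := idealK_elementColon_ne_bot hN.1 hx0
  have h1 : (1 : K) ∈ s.star (idealK R K (elementColon N x)) := by
    have hone : IsFrac R K (1 : Submodule R K) :=
      isFrac_of_le_one (ne_bot_of_le_ne_bot hne (idealK_le_one _)) le_rfl
    rw [idealK_elementColon N hx0, hinter _ _ (hN.smul hxinv) hone, s.star_one,
      s.star_smul _ hxinv _ hN]
    refine ⟨?_, Submodule.one_le.1 le_rfl⟩
    have := Submodule.smul_mem_pointwise_smul x x⁻¹ _ hx
    rwa [smul_eq_mul, inv_mul_cancel₀ hx0] at this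
  by_contra h
  have hle : elementColon N x ≤ M := fun r hr => by
    by_contra hrM
    exact h ⟨r, hrM, hr⟩
  exact hmax.one_notMem (s.star_mono _ _ (isFrac_idealK hne)
    (isFrac_idealK (ne_bot_of_le_ne_bot hne (idealK_mono hle))) (idealK_mono hle) h1)

lemma mem_star_of_forall_exists (hft : s.FiniteType) {N : Submodule R K} (hN : IsFrac R K N) {x : K}
    (h : ∀ M : Ideal R, M ≠ ⊥ → s.MaxIdeal M → ∃ r ∉ M, r • x ∈ N) : x ∈ s.star N := by
  by_cases hx0 : x = 0
  · exact hx0 ▸ Submodule.zero_mem _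
  have hne := idealK_elementColon_ne_bot hN.1 hx0
  have h1 : (1 : K) ∈ s.star (idealK R K (elementColon N x)) := by
    by_contra h1
    obtain ⟨M, ⟨hM, hmax⟩, hle⟩ := hft.exists_le_maxIdeal hne h1
    obtain ⟨r, hr, hrx⟩ := h M hM hmax
    exact hr (hle hrx)
  have hx1 : x ∈ x • s.star (idealK R K (elementColon N x)) := by
    simpa using Submodule.smul_mem_pointwise_smul 1 x _ h1
  rw [← s.star_smul x hx0 _ (isFrac_idealK hne)] at hx1
  refine s.star_mono _ _ ((isFrac_idealK hne).smul hx0) hN ?_ hx1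
  intro y hy
  obtain ⟨_, ⟨r, hr, rfl⟩, rfl⟩ := (Submodule.mem_smul_pointwise_iff_exists _ _ _).1 hy
  rw [smul_eq_mul, mul_comm, Algebra.linearMap_apply, ← Algebra.smul_def]
  exact hr

lemma FiniteType.exists_fg_not_le (hft : s.FiniteType) {H : Ideal R}
    (hH : ∀ M : Ideal R, M ≠ ⊥ → s.MaxIdeal M → ¬ H ≤ M) :
    ∃ H' ≤ H, H'.FG ∧ ∀ M : Ideal R, M ≠ ⊥ → s.MaxIdeal M → ¬ H' ≤ M := by
  by_cases h0 : H = ⊥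
  · exact ⟨⊥, bot_le, Submodule.fg_bot, h0 ▸ hH⟩
  obtain ⟨a, ha, ha0⟩ := Submodule.exists_mem_ne_zero_of_ne_bot h0
  have hne := idealK_ne_bot (K := K) ha0 ha
  have h1 : (1 : K) ∈ s.star (idealK R K H) := by
    by_contra h1
    obtain ⟨M, ⟨hM, hmax⟩, hle⟩ := hft.exists_le_maxIdeal hne h1
    exact hH M hM hmax hle
  obtain ⟨F, hF, hF0, hFfg, h1F⟩ := hft.exists_fg (isFrac_idealK hne) h1
  have hFeq := idealK_comap_of_le_one (hF.trans (idealK_le_one _))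
  refine ⟨F.comap (Algebra.linearMap R K), fun r hr => algebraMap_mem_idealK.1 (hF hr),
    ideal_fg_of_idealK_fg (hFeq.symm ▸ hFfg),
    fun M hM hmax hle => ?_⟩
  have hFM := idealK_mono (K := K) hle
  rw [hFeq] at hFM
  have hMfrac := isFrac_idealK (ne_bot_of_le_ne_bot hF0 hFM)
  exact hmax.one_notMem (s.star_mono _ _ (hMfrac.mono hF0 hFM) hMfrac hFM h1F)

end StarOperation

end StarOperation

/-- If `*` is a star operation on `R` which is spectral and of finite type
(i.e. of finite type and distributing over finite intersections) and `R` is Clifford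
`*`-regular, then `R` has `*`-finite character: every nonzero element of `R` lies in only
finitely many `*`-maximal ideals. -/
theorem star_finite_character_of_clifford_regular
    {R K : Type*} [CommRing R] [IsDomain R] [Field K] [Algebra R K] [IsFractionRing R K]
    (s : StarOperation R K) (hft : s.FiniteType)
    (hinter : ∀ I J : Submodule R K, IsFrac R K I → IsFrac R K J →
      s.star (I ⊓ J) = s.star I ⊓ s.star J)
    (hreg : ∀ I : Submodule R K, IsFrac R K I → s.Regular I) :
    ∀ r : R, r ≠ 0 → {M : Ideal R | s.MaxIdeal M ∧ r ∈ M}.Finite := by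
  intro r hr
  let κ := {M : Ideal R // M ≠ ⊥ ∧ s.MaxIdeal M}
  let 𝓜 : κ → Ideal R := Subtype.val
  have hprime : ∀ k, (𝓜 k).IsPrime := fun k => k.2.2.isPrime hft k.2.1
  have hincomp : ∀ k l, 𝓜 k ≤ 𝓜 l → k = l := fun k l h =>
    Subtype.ext (k.2.2.2.2 l.1 l.2.2.1 l.2.2.2.1 h).symm
  have hcpt : ∀ H : Ideal R, (∀ k, ¬ H ≤ 𝓜 k) → ∃ H' ≤ H, H'.FG ∧ ∀ k, ¬ H' ≤ 𝓜 k := by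
    intro H hH
    obtain ⟨H', hle, hfg, h⟩ := hft.exists_fg_not_le fun M hM hmax => hH ⟨M, hM, hmax⟩
    exact ⟨H', hle, hfg, fun k => h k.1 k.2.1 k.2.2⟩
  have hone : ∀ y : K, (∀ k, y ∈ saturation (𝓜 k).primeCompl (1 : Submodule R K)) →
      y ∈ (1 : Submodule R K) := by
    intro y hy
    rw [← s.star_one]
    exact s.mem_star_of_forall_exists hft (isFrac_of_le_one one_ne_zero le_rfl)
      fun M hM hmax => hy ⟨M, hM, hmax⟩
  have hloc : ∀ I : Submodule R K, IsFrac R K I → ∃ J : Submodule R K,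
      ∀ k, I ≤ saturation (𝓜 k).primeCompl (I * I * J) ∧
        I * I * J ≤ saturation (𝓜 k).primeCompl I := by
    intro I hI
    obtain ⟨J, hJ, hIJ⟩ := hreg I hI
    have hIIJ := (hI.mul hI).mul hJ
    refine ⟨J, fun k => ⟨fun x hx => ?_, fun x hx => ?_⟩⟩
    · exact StarOperation.mem_saturation_of_mem_star hinter k.2.2 hIIJ
        (hIJ ▸ s.le_star _ hI hx)
    · exact StarOperation.mem_saturation_of_mem_star hinter k.2.2 hI
        (hIJ ▸ s.le_star _ hIIJ hx)
  have hfin : {k | r ∈ 𝓜 k}.Finite :=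
    finite_of_no_infinite_comaximal_family hincomp hcpt
      fun I hI hrI hproper hcomax =>
        not_infinite_comaximal_family hone hloc hcpt hr I hI hrI hproper hcomax
  refine (hfin.image 𝓜).subset ?_
  rintro M ⟨hmax, hrM⟩
  exact ⟨⟨M, fun h => hr (by simpa [h] using hrM), hmax⟩, hrM, rfl⟩
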